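/- arXiv:2202.11095 — 4 statements merged into one kernel-verified Lean document; each statement's English description precedes it below -/
import Mathlib

section
/- Let (V, E, q, 𝒮, r) be an instance of the reserved b-matching problem and let μ' ⊆ μ be two reserved b-matchings. Let e = (u, v) ∈ E \ μ and let S ∈ 𝒮 with v ∈ S. Suppose deg_{μ'}(v) = q(v) − 1 and there exists a set S' ⊆ S \ {v} with |S'| = |S| − r(S) such that every vertex of S' meets its quota in μ'. Then deg_μ(v) = q(v) − 1, and μ ∪ {e} is not a reserved b-matching: adding e to μ makes v meet its quota, so that strictly more than |S| − r(S) vertices of S meet their quota, violating the reservation constraint for S. -/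
open Finset

/-- The degree of vertex `v` in the edge set `μ`: the number of edges of `μ` incident to `v`. -/
def degOn {V : Type*} [DecidableEq V] (μ : Finset (Sym2 V)) (v : V) : ℕ :=
  (μ.filter fun s => v ∈ s).card

/-- `v` meets its quota in `μ`. -/
def MeetsQuota {V : Type*} [DecidableEq V] (q : V → ℕ) (μ : Finset (Sym2 V)) (v : V) : Prop :=
  degOn μ v = q v

/-- `μ` is a `b`-matching with respect to the quota function `q`. -/
def IsBMatching {V : Type*} [DecidableEq V] (q : V → ℕ) (μ : Finset (Sym2 V)) : Prop :=
  ∀ v, degOn μ v ≤ q v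

/-- `μ` is a reserved `b`-matching: a `b`-matching such that for every `S ∈ 𝒮` at most
`|S| - r S` vertices of `S` meet their quota in `μ`. -/
def IsReservedBMatching {V : Type*} [DecidableEq V] (q : V → ℕ) (𝒮 : Finset (Finset V))
    (r : Finset V → ℕ) (μ : Finset (Sym2 V)) : Prop :=
  IsBMatching q μ ∧ ∀ S ∈ 𝒮, (S.filter fun v => degOn μ v = q v).card ≤ S.card - r S

theorem degOn_mono {V : Type*} [DecidableEq V] {μ ν : Finset (Sym2 V)} (h : μ ⊆ ν) (v : V) :
    degOn μ v ≤ degOn ν v :=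
  card_le_card (filter_subset_filter _ h)

theorem degOn_insert {V : Type*} [DecidableEq V] {μ : Finset (Sym2 V)} {e : Sym2 V} {v : V}
    (he : e ∉ μ) (hv : v ∈ e) : degOn (insert e μ) v = degOn μ v + 1 := by
  unfold degOn
  rw [filter_insert, if_pos hv, card_insert_of_notMem (by simp [he])]

theorem MeetsQuota.mono {V : Type*} [DecidableEq V] {q : V → ℕ} {μ ν : Finset (Sym2 V)} {v : V}
    (hv : MeetsQuota q μ v) (h : μ ⊆ ν) (hν : IsBMatching q ν) : MeetsQuota q ν v :=
  (hν v).antisymm (hv.symm.trans_le (degOn_mono h v))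

/-- If the reservation of `S` is already exhausted by vertices other than `v`, then `v` does not
meet its quota. -/
theorem IsReservedBMatching.not_meetsQuota {V : Type*} [DecidableEq V] {q : V → ℕ}
    {𝒮 : Finset (Finset V)} {r : Finset V → ℕ} {ν : Finset (Sym2 V)}
    (hν : IsReservedBMatching q 𝒮 r ν) {S S' : Finset V} (hS : S ∈ 𝒮) {v : V} (hv : v ∈ S)
    (hsub : S' ⊆ S.erase v) (hcard : S'.card = S.card - r S)
    (hmeet : ∀ w ∈ S', MeetsQuota q ν w) : ¬ MeetsQuota q ν v := by
  intro hvq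
  have hle : (insert v S').card ≤ (S.filter fun w => degOn ν w = q w).card := by
    refine card_le_card (insert_subset (mem_filter.2 ⟨hv, hvq⟩) fun w hw => ?_)
    exact mem_filter.2 ⟨mem_of_mem_erase (hsub hw), hmeet w hw⟩
  rw [card_insert_of_notMem fun h => notMem_erase v S (hsub h)] at hle
  have := hν.2 S hS
  omega

/-- Let `(V, E, q, 𝒮, r)` be an instance of the reserved `b`-matching problem and
`μ' ⊆ μ` two reserved `b`-matchings. Let `e = s(u,v) ∈ E \ μ` and `S ∈ 𝒮` with `v ∈ S`.
Suppose `deg_{μ'}(v) = q v - 1` and there is `S' ⊆ S \ {v}` with `|S'| = |S| - r S` all of whose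
vertices meet their quota in `μ'`. Then `deg_μ(v) = q v - 1`, adding `e` to `μ` makes `v` meet
its quota, and `μ ∪ {e}` is not a reserved `b`-matching (it violates the reservation for `S`). -/
theorem reservation_blocks_edge {V : Type*} [DecidableEq V]
    (q : V → ℕ) (𝒮 : Finset (Finset V)) (r : Finset V → ℕ) (E : Finset (Sym2 V))
    (μ μ' : Finset (Sym2 V)) (hμE : μ ⊆ E)
    (hsub : μ' ⊆ μ)
    (hres : IsReservedBMatching q 𝒮 r μ) (hres' : IsReservedBMatching q 𝒮 r μ')
    (u v : V) (e : Sym2 V) (he : e = s(u, v)) (heE : e ∈ E) (heμ : e ∉ μ)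
    (S : Finset V) (hS : S ∈ 𝒮) (hvS : v ∈ S)
    (hdeg : degOn μ' v = q v - 1)
    (S' : Finset V) (hS'sub : S' ⊆ S.erase v) (hS'card : S'.card = S.card - r S)
    (hS'meet : ∀ w ∈ S', MeetsQuota q μ' w) :
    degOn μ v = q v - 1 ∧
    degOn (insert e μ) v = q v ∧
    ¬ IsReservedBMatching q 𝒮 r (insert e μ) := by
  have blocked : ∀ ν, μ' ⊆ ν → IsReservedBMatching q 𝒮 r ν → degOn ν v ≠ q v := fun ν hν h =>
    h.not_meetsQuota hS hvS hS'sub hS'card fun w hw => (hS'meet w hw).mono hν h.1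
  have hne' := blocked μ' subset_rfl hres'
  have hne := blocked μ hsub hres
  have hle := hres.1 v
  have hmono := degOn_mono hsub v
  have hins : degOn (insert e μ) v = degOn μ v + 1 := degOn_insert heμ (by simp [he])
  have hmeet : degOn (insert e μ) v = q v := by omega
  exact ⟨by omega, hmeet, fun h => blocked _ (hsub.trans (subset_insert e μ)) h hmeet⟩
end

section
/- Let T = (a, a', a'', e, e', e'') be a potential blocking tuple for a matching μ in the affiliate matching problem in which e' and a'' are dummies (so a matches e using spare capacity and no applicant a'' is introduced), and let μ* be the swapped matching of μ with respect to T. Let I_a, I_{a'} ∈ {0,1} be the respective indicators that a and a' belong to aff(e) (preference values with dummy arguments being taken as 0). If pr_e^e(a') + λ I_{a'} pr_e^{a'}(e) ≥ pr_e^e(a) + λ I_a pr_e^{a}(e) + λ I_{a'} pr_e^{a'}(e''), then val_e(μ*) ≤ val_e(μ); in particular, e does not strictly prefer μ* to μ. -/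
open Finset

/-- The set of employers matched to applicant `a` in the matching `μ` (viewed as a set of
applicant–employer pairs). -/
def matchedE {A E : Type*} [DecidableEq A] [DecidableEq E] (μ : Finset (A × E)) (a : A) :
    Finset E :=
  (μ.filter fun p => p.1 = a).image Prod.snd

/-- The set of applicants matched to employer `e` in the matching `μ`. -/
def matchedA {A E : Type*} [DecidableEq A] [DecidableEq E] (μ : Finset (A × E)) (e : E) :
    Finset A :=
  (μ.filter fun p => p.2 = e).image Prod.fst

/-- The valuation of applicant `a` for the matching `μ`:  `val_a(μ) = ∑_{e ∈ μ(a)} pr_a(e)`. -/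
def valA {A E : Type*} [DecidableEq A] [DecidableEq E] (prA : A → E → ℝ)
    (μ : Finset (A × E)) (a : A) : ℝ :=
  ∑ x ∈ matchedE μ a, prA a x

/-- The valuation of employer `e` for the matching `μ`:
`val_e(μ) = ∑_{a ∈ μ(e)} pr_e^e(a) + λ ∑_{a ∈ aff(e)} ∑_{e* ∈ μ(a)} pr_e^a(e*)`. -/
def valE {A E : Type*} [DecidableEq A] [DecidableEq E] (aff : E → Finset A) (lam : ℝ)
    (prEE : E → A → ℝ) (prEA : E → A → E → ℝ) (μ : Finset (A × E)) (e : E) : ℝ :=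
  ∑ b ∈ matchedA μ e, prEE e b + lam * ∑ b ∈ aff e, ∑ x ∈ matchedE μ b, prEA e b x

/-- `μ` is a matching respecting the capacity quotas `qA` (applicants) and `qE` (employers). -/
def IsMatching {A E : Type*} [DecidableEq A] [DecidableEq E] (qA : A → ℕ) (qE : E → ℕ)
    (μ : Finset (A × E)) : Prop :=
  (∀ a, (matchedE μ a).card ≤ qA a) ∧ ∀ e, (matchedA μ e).card ≤ qE e

/-- The pair `(a, e)` as a (possibly empty) finite set, where `a` and `e` may be dummies. -/
def optPair {A E : Type*} : Option A → Option E → Finset (A × E)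
  | some a, some e => {(a, e)}
  | _, _ => ∅

/-- The swapped matching of `μ` with respect to the tuple `(a, a', a'', e, e', e'')`:
add the pair `(a, e)`, remove the pairs `(a, e')` and `(a', e)` when the corresponding entries
are non-dummy, and add the pairs `(a'', e')` and `(a', e'')` when the corresponding entries are
non-dummy. -/
def swapped {A E : Type*} [DecidableEq A] [DecidableEq E] (μ : Finset (A × E)) (a : A)
    (a' a'' : Option A) (e : E) (e' e'' : Option E) : Finset (A × E) :=
  ((μ \ (optPair (some a) e' ∪ optPair a' (some e))) ∪ {(a, e)})
    ∪ optPair a'' e' ∪ optPair a' e''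

/-- `(a, a', a'', e, e', e'')` is a potential blocking tuple for `μ`:  `e ∉ μ(a)`,
`e'` is an element of `μ(a)` or a dummy, `a'` is an element of `μ(e)` or a dummy, and
`a''` and `e''` are an applicant other than `a` and an employer other than `e`, or dummies. -/
def IsPotentialBlockingTuple {A E : Type*} [DecidableEq A] [DecidableEq E]
    (μ : Finset (A × E)) (a : A) (a' a'' : Option A) (e : E) (e' e'' : Option E) : Prop :=
  (a, e) ∉ μ ∧ (∀ x, e' = some x → (a, x) ∈ μ) ∧ (∀ b, a' = some b → (b, e) ∈ μ) ∧
    a'' ≠ some a ∧ e'' ≠ some e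

/-- `pr_e^e(·)` extended to a possibly-dummy applicant argument (dummy values are `0`). -/
def prEEo {A E : Type*} (prEE : E → A → ℝ) (e : E) : Option A → ℝ
  | some b => prEE e b
  | none => 0

/-- `pr_e^{·}(·)` extended to possibly-dummy arguments (dummy values are `0`). -/
def prEAo {A E : Type*} (prEA : E → A → E → ℝ) (e : E) : Option A → Option E → ℝ
  | some b, some x => prEA e b x
  | _, _ => 0

/-- The indicator that a possibly-dummy applicant belongs to `aff(e)`. -/
def affInd {A E : Type*} [DecidableEq A] (aff : E → Finset A) (e : E) : Option A → ℝ
  | some b => if b ∈ aff e then 1 else 0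
  | none => 0

/-- The contribution of a matched pair to the valuation of the employer `e`. -/
def pairWeight {A E : Type*} [DecidableEq A] [DecidableEq E] (aff : E → Finset A) (lam : ℝ)
    (prEE : E → A → ℝ) (prEA : E → A → E → ℝ) (e : E) (p : A × E) : ℝ :=
  (if p.2 = e then prEE e p.1 else 0) + lam * (if p.1 ∈ aff e then prEA e p.1 p.2 else 0)

theorem sum_matchedA {A E : Type*} [DecidableEq A] [DecidableEq E] (μ : Finset (A × E)) (e : E)
    (f : A → ℝ) : ∑ b ∈ matchedA μ e, f b = ∑ p ∈ μ, if p.2 = e then f p.1 else 0 := by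
  rw [matchedA, Finset.sum_image, Finset.sum_filter]
  intro p hp q hq h
  simp only [Finset.coe_filter, Set.mem_ofPred_eq] at hp hq
  exact Prod.ext h (hp.2.trans hq.2.symm)

theorem sum_matchedE {A E : Type*} [DecidableEq A] [DecidableEq E] (μ : Finset (A × E)) (b : A)
    (f : E → ℝ) : ∑ x ∈ matchedE μ b, f x = ∑ p ∈ μ, if p.1 = b then f p.2 else 0 := by
  rw [matchedE, Finset.sum_image, Finset.sum_filter]
  intro p hp q hq h
  simp only [Finset.coe_filter, Set.mem_ofPred_eq] at hp hq
  exact Prod.ext (hp.2.trans hq.2.symm) h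

theorem valE_eq_sum_pairWeight {A E : Type*} [DecidableEq A] [DecidableEq E]
    (aff : E → Finset A) (lam : ℝ) (prEE : E → A → ℝ) (prEA : E → A → E → ℝ)
    (μ : Finset (A × E)) (e : E) :
    valE aff lam prEE prEA μ e = ∑ p ∈ μ, pairWeight aff lam prEE prEA e p := by
  simp only [valE, pairWeight, sum_matchedA, sum_matchedE, Finset.sum_add_distrib,
    ← Finset.mul_sum]
  rw [Finset.sum_comm]
  simp only [Finset.sum_ite_eq]

theorem sum_union_le_of_nonneg {ι : Type*} [DecidableEq ι] {w : ι → ℝ} (hw : ∀ i, 0 ≤ w i)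
    (s t : Finset ι) : ∑ i ∈ s ∪ t, w i ≤ ∑ i ∈ s, w i + ∑ i ∈ t, w i := by
  have h := Finset.sum_union_inter (s₁ := s) (s₂ := t) (f := w)
  have := Finset.sum_nonneg fun i (_ : i ∈ s ∩ t) => hw i
  linarith

/-- Let `T = (a, a', a'', e, e', e'')` be a potential blocking tuple for `μ` in
which `e'` and `a''` are dummies, and `μ*` the swapped matching of `μ` w.r.t. `T`.  With
`I_a, I_{a'}` the indicators that `a, a'` belong to `aff(e)` (dummy preference values taken
as `0`), if `pr_e^e(a') + λ I_{a'} pr_e^{a'}(e) ≥ pr_e^e(a) + λ I_a pr_e^a(e) + λ I_{a'}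
pr_e^{a'}(e'')`, then `val_e(μ*) ≤ val_e(μ)`; in particular `e` does not strictly prefer `μ*`
to `μ`. -/
theorem employer_does_not_prefer_swap_dummy {A E : Type*} [DecidableEq A] [DecidableEq E]
    (aff : E → Finset A) (lam : ℝ) (hlam : 0 < lam)
    (prA : A → E → ℝ) (prEE : E → A → ℝ) (prEA : E → A → E → ℝ)
    (hprA : ∀ a e, prA a e = 0 ∨ prA a e = 1)
    (hprEE : ∀ e b, prEE e b = 0 ∨ prEE e b = 1)
    (hprEA : ∀ e b x, prEA e b x = 0 ∨ prEA e b x = 1)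
    (qA : A → ℕ) (qE : E → ℕ) (μ : Finset (A × E)) (hμ : IsMatching qA qE μ)
    (a : A) (a' : Option A) (e : E) (e'' : Option E)
    (hT : IsPotentialBlockingTuple μ a a' (none : Option A) e (none : Option E) e'')
    (hineq :
      prEEo prEE e a' + lam * affInd aff e a' * prEAo prEA e a' (some e)
        ≥ prEE e a + lam * (if a ∈ aff e then 1 else 0) * prEA e a e
          + lam * affInd aff e a' * prEAo prEA e a' e'') :
    valE aff lam prEE prEA (swapped μ a a' none e none e'') e ≤ valE aff lam prEE prEA μ e ∧
      ¬ valE aff lam prEE prEA μ e <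
          valE aff lam prEE prEA (swapped μ a a' none e none e'') e := by
  have hEE : ∀ b, 0 ≤ prEE e b := fun b => by rcases hprEE e b with h | h <;> simp [h]
  have hEA : ∀ b x, 0 ≤ prEA e b x := fun b x => by rcases hprEA e b x with h | h <;> simp [h]
  have hw : ∀ p, 0 ≤ pairWeight aff lam prEE prEA e p := fun p => by
    have h₁ := hEE p.1
    have h₂ := hEA p.1 p.2
    unfold pairWeight
    positivity
  obtain ⟨-, -, hmem, -, hne⟩ := hT
  suffices h : valE aff lam prEE prEA (swapped μ a a' none e none e'') e
      ≤ valE aff lam prEE prEA μ e from ⟨h, not_lt.mpr h⟩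
  rw [valE_eq_sum_pairWeight, valE_eq_sum_pairWeight]
  have hsub : optPair a' (some e) ⊆ μ := by
    cases a' with
    | none => simp [optPair]
    | some b => simpa [optPair] using hmem b rfl
  have hsdiff := Finset.sum_sdiff (f := pairWeight aff lam prEE prEA e) hsub
  have hadd := sum_union_le_of_nonneg hw (μ \ optPair a' (some e)) {(a, e)}
  have hswap := sum_union_le_of_nonneg hw ((μ \ optPair a' (some e)) ∪ {(a, e)}) (optPair a' e'')
  have hset : swapped μ a a' none e none e''
      = ((μ \ optPair a' (some e)) ∪ {(a, e)}) ∪ optPair a' e'' := by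
    simp [swapped, optPair]
  have hnew : ∑ p ∈ ({(a, e)} : Finset (A × E)), pairWeight aff lam prEE prEA e p
      = prEE e a + lam * (if a ∈ aff e then 1 else 0) * prEA e a e := by
    simp [pairWeight]
  have hold : ∑ p ∈ optPair a' (some e), pairWeight aff lam prEE prEA e p
      = prEEo prEE e a' + lam * affInd aff e a' * prEAo prEA e a' (some e) := by
    cases a' <;> simp [optPair, pairWeight, prEEo, affInd, prEAo]
  have hrematch : ∑ p ∈ optPair a' e'', pairWeight aff lam prEE prEA e p
      = lam * affInd aff e a' * prEAo prEA e a' e'' := by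
    cases a' <;> cases e'' <;> simp [optPair, pairWeight, affInd, prEAo]
    rintro rfl
    exact absurd rfl hne
  rw [hset]
  linarith
end

section
/- Let T = (a, a', a'', e, e', e'') be a potential blocking tuple for a matching μ in the affiliate matching problem in which e' and a'' are dummies, and let μ* be the swapped matching of μ with respect to T. Suppose 0 < λ ≤ 1, a ∈ aff(e), a' ∉ aff(e), and pr_e^e(a') = 1. If e strictly prefers μ* to μ (i.e., val_e(μ*) > val_e(μ)), then pr_e^e(a) = 1 and pr_e^{a}(e) = 1. -/
open Finset

theorem mem_matchedE {A E : Type*} [DecidableEq A] [DecidableEq E] {μ : Finset (A × E)} {a : A}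
    {e : E} : e ∈ matchedE μ a ↔ (a, e) ∈ μ := by
  simp [matchedE]

theorem mem_matchedA {A E : Type*} [DecidableEq A] [DecidableEq E] {μ : Finset (A × E)} {a : A}
    {e : E} : a ∈ matchedA μ e ↔ (a, e) ∈ μ := by
  simp [matchedA]

/-- Membership in the swapped matching when `e'` and `a''` are dummies. -/
theorem mem_swapped_none_none {A E : Type*} [DecidableEq A] [DecidableEq E] {μ : Finset (A × E)}
    {a b c : A} {e x : E} {e'' : Option E} :
    (c, x) ∈ swapped μ a (some b) none e none e'' ↔
      (((c, x) ∈ μ ∧ ¬(c = b ∧ x = e)) ∨ (c = a ∧ x = e)) ∨ (c = b ∧ some x = e'') := by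
  cases e'' <;> simp [swapped, optPair] <;> tauto

/-- Let `T = (a, a', a'', e, e', e'')` be a potential blocking tuple for `μ` in
which `e'` and `a''` are dummies, and `μ*` the swapped matching of `μ` w.r.t. `T`.  Suppose
`0 < λ ≤ 1`, `a ∈ aff(e)`, `a' ∉ aff(e)` (with `a' = some b` non-dummy), and `pr_e^e(a') = 1`.
If `e` strictly prefers `μ*` to `μ`, then `pr_e^e(a) = 1` and `pr_e^a(e) = 1`. -/
theorem employer_prefers_swap_forces_prefs {A E : Type*} [DecidableEq A] [DecidableEq E]
    (aff : E → Finset A) (lam : ℝ) (hlam : 0 < lam) (hlam1 : lam ≤ 1)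
    (prA : A → E → ℝ) (prEE : E → A → ℝ) (prEA : E → A → E → ℝ)
    (hprA : ∀ a e, prA a e = 0 ∨ prA a e = 1)
    (hprEE : ∀ e b, prEE e b = 0 ∨ prEE e b = 1)
    (hprEA : ∀ e b x, prEA e b x = 0 ∨ prEA e b x = 1)
    (qA : A → ℕ) (qE : E → ℕ) (μ : Finset (A × E)) (hμ : IsMatching qA qE μ)
    (a : A) (a' : Option A) (e : E) (e'' : Option E)
    (hT : IsPotentialBlockingTuple μ a a' (none : Option A) e (none : Option E) e'')
    (b : A) (hb : a' = some b)
    (haff : a ∈ aff e) (hbaff : b ∉ aff e) (hb1 : prEE e b = 1)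
    (hpref : valE aff lam prEE prEA μ e <
      valE aff lam prEE prEA (swapped μ a a' none e none e'') e) :
    prEE e a = 1 ∧ prEA e a e = 1 := by
  subst hb
  obtain ⟨hae, -, hbe, -, he''⟩ := hT
  have hbe : (b, e) ∈ μ := hbe b rfl
  have hab : a ≠ b := by rintro rfl; exact hae hbe
  have hA : matchedA (swapped μ a (some b) none e none e'') e =
      insert a ((matchedA μ e).erase b) := by
    ext c
    simp only [mem_matchedA, mem_swapped_none_none, mem_insert, mem_erase]
    grind
  have hEa : matchedE (swapped μ a (some b) none e none e'') a = insert e (matchedE μ a) := by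
    ext x
    simp only [mem_matchedE, mem_swapped_none_none, mem_insert]
    grind
  have hE : ∀ c ∈ (aff e).erase a,
      matchedE (swapped μ a (some b) none e none e'') c = matchedE μ c := by
    intro c hc
    ext x
    simp only [mem_matchedE, mem_swapped_none_none]
    grind
  have hsumA : ∑ c ∈ matchedA (swapped μ a (some b) none e none e'') e, prEE e c =
      prEE e a + (∑ c ∈ matchedA μ e, prEE e c - 1) := by
    rw [hA, sum_insert (by simp [mem_matchedA, hae]),
      sum_erase_eq_sub (mem_matchedA.2 hbe), hb1]
  have hsumE : ∑ c ∈ aff e, ∑ x ∈ matchedE (swapped μ a (some b) none e none e'') c, prEA e c x =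
      prEA e a e + ∑ c ∈ aff e, ∑ x ∈ matchedE μ c, prEA e c x := by
    rw [← add_sum_erase _ _ haff, ← add_sum_erase _ _ haff, hEa,
      sum_insert (by simp [mem_matchedE, hae]), add_assoc]
    congr 2
    exact sum_congr rfl fun c hc => by rw [hE c hc]
  rw [valE, valE, hsumA, hsumE] at hpref
  rcases hprEE e a with h | h <;> rcases hprEA e a e with h' | h' <;> rw [h, h'] at hpref
  · linarith
  · linarith
  · linarith
  · exact ⟨h, h'⟩
end

section
/- Let T = (a, a', a'', e, e', e'') be a potential blocking tuple for a matching μ in the affiliate matching problem in which e' and a'' are dummies, and let μ* be the swapped matching of μ with respect to T. Suppose a' ∈ aff(e), a ∉ aff(e), and pr_e^e(a') = 1 and pr_e^{a'}(e) = 1. Then val_e(μ*) ≤ val_e(μ); in particular, e does not strictly prefer μ* to μ, so T does not block μ. -/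
open Finset

/-- `(a, a', a'', e, e', e'')` is a blocking tuple for `μ`: a potential blocking tuple such that
both `a` and `e` strictly prefer the swapped matching to `μ`. -/
def IsBlockingTuple {A E : Type*} [DecidableEq A] [DecidableEq E] (aff : E → Finset A)
    (lam : ℝ) (prA : A → E → ℝ) (prEE : E → A → ℝ) (prEA : E → A → E → ℝ)
    (μ : Finset (A × E)) (a : A) (a' a'' : Option A) (e : E) (e' e'' : Option E) : Prop :=
  IsPotentialBlockingTuple μ a a' a'' e e' e'' ∧
    valA prA μ a < valA prA (swapped μ a a' a'' e e' e'') a ∧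
    valE aff lam prEE prEA μ e < valE aff lam prEE prEA (swapped μ a a' a'' e e' e'') e

theorem mem_optPair_some {A E : Type*} {b c : A} {o : Option E} {x : E} :
    (c, x) ∈ optPair (some b) o ↔ c = b ∧ o = some x := by
  cases o <;> simp [optPair, eq_comm]

theorem mem_swapped_none {A E : Type*} [DecidableEq A] [DecidableEq E] {μ : Finset (A × E)}
    {a b c : A} {e x : E} {o : Option E} :
    (c, x) ∈ swapped μ a (some b) none e none o ↔
      ((c, x) ∈ μ ∧ ¬ (c = b ∧ x = e)) ∨ (c = a ∧ x = e) ∨ (c = b ∧ o = some x) := by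
  simp only [swapped, mem_union, mem_sdiff, mem_optPair_some, mem_singleton, Prod.mk.injEq]
  simp [optPair, eq_comm, or_assoc]

/-- Exchanging an element of maximal value `1` for an element of a set with at most one element
does not increase the sum of a `0/1`-valued function. -/
theorem sum_le_sum_of_exchange {α : Type*} [DecidableEq α] {f : α → ℝ}
    (hf : ∀ x, f x = 0 ∨ f x = 1) {s t : Finset α} {y : α} (hy : y ∈ s) (hfy : f y = 1)
    {o : Option α} (ht : ∀ x ∈ t, x ∈ s.erase y ∨ o = some x) :
    ∑ x ∈ t, f x ≤ ∑ x ∈ s, f x := by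
  have h0 : ∀ x, 0 ≤ f x := fun x => by rcases hf x with h | h <;> simp [h]
  have h1 : ∀ x, f x ≤ 1 := fun x => by rcases hf x with h | h <;> simp [h]
  have hsub : t ⊆ s.erase y ∪ o.toFinset := fun x hx => by
    simpa [mem_union, eq_comm] using ht x hx
  have ho : ∑ x ∈ o.toFinset, f x ≤ 1 := by
    cases o <;> simp [h1]
  have hinter : 0 ≤ ∑ x ∈ s.erase y ∩ o.toFinset, f x := sum_nonneg fun x _ => h0 x
  have hunion := sum_union_inter (s₁ := s.erase y) (s₂ := o.toFinset) (f := f)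
  have hle : ∑ x ∈ t, f x ≤ ∑ x ∈ s.erase y ∪ o.toFinset, f x :=
    sum_le_sum_of_subset_of_nonneg hsub fun x _ _ => h0 x
  have herase := add_sum_erase s f hy
  linarith

/-- Let `T = (a, a', a'', e, e', e'')` be a potential blocking tuple for `μ` in
which `e'` and `a''` are dummies, and `μ*` the swapped matching of `μ` w.r.t. `T`.  Suppose
`a' ∈ aff(e)` (with `a' = some b` non-dummy), `a ∉ aff(e)`, `pr_e^e(a') = 1` and
`pr_e^{a'}(e) = 1`.  Then `val_e(μ*) ≤ val_e(μ)`; in particular `e` does not strictly prefer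
`μ*` to `μ`, so `T` does not block `μ`. -/
theorem swap_with_liked_affiliate_not_blocking {A E : Type*} [DecidableEq A] [DecidableEq E]
    (aff : E → Finset A) (lam : ℝ) (hlam : 0 < lam)
    (prA : A → E → ℝ) (prEE : E → A → ℝ) (prEA : E → A → E → ℝ)
    (hprA : ∀ a e, prA a e = 0 ∨ prA a e = 1)
    (hprEE : ∀ e b, prEE e b = 0 ∨ prEE e b = 1)
    (hprEA : ∀ e b x, prEA e b x = 0 ∨ prEA e b x = 1)
    (qA : A → ℕ) (qE : E → ℕ) (μ : Finset (A × E)) (hμ : IsMatching qA qE μ)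
    (a : A) (a' : Option A) (e : E) (e'' : Option E)
    (hT : IsPotentialBlockingTuple μ a a' (none : Option A) e (none : Option E) e'')
    (b : A) (hb : a' = some b)
    (hbaff : b ∈ aff e) (haff : a ∉ aff e) (hb1 : prEE e b = 1) (hb2 : prEA e b e = 1) :
    valE aff lam prEE prEA (swapped μ a a' none e none e'') e ≤ valE aff lam prEE prEA μ e ∧
      ¬ IsBlockingTuple aff lam prA prEE prEA μ a a' none e none e'' := by
  subst hb
  obtain ⟨-, -, hmem, -, he''⟩ := hT
  have hbe : (b, e) ∈ μ := hmem b rfl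
  have hab : b ≠ a := fun h => haff (h ▸ hbaff)
  have hval : valE aff lam prEE prEA (swapped μ a (some b) none e none e'') e ≤
      valE aff lam prEE prEA μ e := by
    refine add_le_add ?_ (mul_le_mul_of_nonneg_left (sum_le_sum fun c hc => ?_) hlam.le)
    · refine sum_le_sum_of_exchange (hprEE e) (mem_matchedA.2 hbe) hb1 (o := some a) ?_
      intro c hc
      rw [mem_matchedA, mem_swapped_none] at hc
      rw [mem_erase, mem_matchedA, Option.some_inj]
      grind
    · have hca : c ≠ a := fun h => haff (h ▸ hc)
      by_cases hcb : c = b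
      · subst hcb
        refine sum_le_sum_of_exchange (hprEA e c) (mem_matchedE.2 hbe) hb2 (o := e'') ?_
        intro x hx
        rw [mem_matchedE, mem_swapped_none] at hx
        rw [mem_erase, mem_matchedE]
        grind
      · have heq : matchedE (swapped μ a (some b) none e none e'') c = matchedE μ c := by
          ext x
          simp [mem_matchedE, mem_swapped_none, hca, hcb]
        rw [heq]
  exact ⟨hval, fun h => h.2.2.not_ge hval⟩
end
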